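/- Let f: X → Y be a simplicial map of simplicial complexes. Suppose Y is n-connected and for every k-simplex σ of Y, the fiber f⁻¹(y) over the barycenter y of σ is (n − k)-connected. Then X is n-connected. -/

import Mathlib

open scoped BigOperators

structure ASC (V : Type) where
  faces : Set (Finset V)
  nonempty_of_mem : ∀ ⦃s⦄, s ∈ faces → s.Nonempty
  down_closed : ∀ ⦃s t : Finset V⦄, s ∈ faces → t ⊆ s → t.Nonempty → t ∈ faces

namespace ASC

variable {V W : Type} [DecidableEq V] [DecidableEq W]

/-- The geometric realization of an abstract simplicial complex, as a subset of `V → ℝ`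
(barycentric coordinates, with the product topology on the subtype). -/
def space (K : ASC V) : Set (V → ℝ) :=
  {x | (∀ v, 0 ≤ x v) ∧ ∃ s ∈ K.faces, (∀ v, v ∉ s → x v = 0) ∧ ∑ v ∈ s, x v = 1}

/-- A vertex map is simplicial if it sends faces to faces. -/
def IsSimplicial (K : ASC V) (L : ASC W) (φ : V → W) : Prop :=
  ∀ s ∈ K.faces, s.image φ ∈ L.faces

/-- The map induced on geometric realizations by a vertex map. -/
noncomputable def push (φ : V → W) (x : V → ℝ) : W → ℝ :=
  fun w => ∑ᶠ v ∈ φ ⁻¹' {w}, x v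

/-- The link of a simplex. -/
def link (K : ASC V) (σ : Finset V) : ASC V where
  faces := {t | t ∈ K.faces ∧ Disjoint σ t ∧ σ ∪ t ∈ K.faces}
  nonempty_of_mem := fun _ ht => K.nonempty_of_mem ht.1
  down_closed := by
    rintro t u ⟨h1, h2, h3⟩ hsub hne
    exact ⟨K.down_closed h1 hsub hne, h2.mono_right hsub,
      K.down_closed h3 (Finset.union_subset_union_right hsub)
        ⟨hne.choose, Finset.mem_union_right _ hne.choose_spec⟩⟩

end ASC

/-- `n`-connectedness of a space (`n` an integer): nonempty when `n ≥ -1`, and all homotopy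
groups in dimensions `≤ n` vanish, at every basepoint. -/
def IsConn (X : Type) [TopologicalSpace X] (n : ℤ) : Prop :=
  (-1 ≤ n → Nonempty X) ∧
    ∀ i : ℕ, (i : ℤ) ≤ n → ∀ x : X, Subsingleton (HomotopyGroup (Fin i) X x)

set_option linter.unusedSectionVars false

namespace ASC

variable {V W : Type} [DecidableEq V] [DecidableEq W]

theorem push_eq_sum (φ : V → W) {x : V → ℝ} {s : Finset V} (hs : ∀ v, v ∉ s → x v = 0) (w : W) :
    push φ x w = ∑ v ∈ s, if φ v = w then x v else 0 := by
  unfold push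
  rw [finsum_mem_def, finsum_eq_sum_of_support_subset (s := s)]
  · refine Finset.sum_congr rfl fun v _ => ?_
    by_cases h : φ v = w <;> simp [h]
  · intro v hv
    by_contra h
    exact hv (Set.indicator_apply_eq_zero.2 fun _ => hs v h)

theorem push_nonneg (φ : V → W) {x : V → ℝ} (hx : ∀ v, 0 ≤ x v) (w : W) : 0 ≤ push φ x w :=
  finsum_nonneg fun v => finsum_nonneg fun _ => hx v

theorem sum_push (φ : V → W) {x : V → ℝ} {s : Finset V} (hs : ∀ v, v ∉ s → x v = 0)
    (τ : Finset W) : ∑ w ∈ τ, push φ x w = ∑ v ∈ s, if φ v ∈ τ then x v else 0 := by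
  simp_rw [push_eq_sum φ hs]
  rw [Finset.sum_comm]
  exact Finset.sum_congr rfl fun v _ => by simp

theorem push_mem_space {X : ASC V} {Y : ASC W} {φ : V → W} (hφ : X.IsSimplicial Y φ)
    {x : V → ℝ} (hx : x ∈ X.space) : push φ x ∈ Y.space := by
  obtain ⟨h0, s, hsX, hs, h1⟩ := hx
  refine ⟨push_nonneg φ h0, s.image φ, hφ s hsX, fun w hw => ?_, ?_⟩
  · rw [push_eq_sum φ hs]
    refine Finset.sum_eq_zero fun v hv => if_neg ?_
    rintro rfl
    exact hw (Finset.mem_image_of_mem φ hv)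
  · rw [sum_push φ hs, ← h1]
    exact Finset.sum_congr rfl fun v hv => if_pos (Finset.mem_image_of_mem φ hv)

theorem sum_le_one_of_mem_space {K : ASC V} {x : V → ℝ} (hx : x ∈ K.space) (t : Finset V) :
    ∑ v ∈ t, x v ≤ 1 := by
  obtain ⟨h0, s, -, hs, h1⟩ := hx
  rw [← h1]
  calc ∑ v ∈ t, x v ≤ ∑ v ∈ t ∪ s, x v :=
        Finset.sum_le_sum_of_subset_of_nonneg Finset.subset_union_left fun v _ _ => h0 v
    _ = ∑ v ∈ s, x v :=
        (Finset.sum_subset Finset.subset_union_right fun v _ hv => hs v hv).symm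

theorem continuousOn_push (K : ASC V) (φ : V → W) : ContinuousOn (push φ) K.space := by
  refine continuousOn_pi.2 fun w x₀ hx₀ => ?_
  obtain ⟨-, s₀, -, hs₀, h1⟩ := hx₀
  let a : (V → ℝ) → ℝ := fun x => ∑ v ∈ s₀, if φ v = w then x v else 0
  have ha : Continuous a := continuous_finsetSum _ fun v _ => by split_ifs <;> fun_prop
  let b : (V → ℝ) → ℝ := fun x => a x + (1 - ∑ v ∈ s₀, x v)
  have hb : Continuous b := by fun_prop
  have hab : b x₀ = a x₀ := by simp [b, h1]
  have key : ∀ x ∈ K.space, a x ≤ push φ x w ∧ push φ x w ≤ b x := by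
    intro x hx
    have hsum := sum_le_one_of_mem_space hx
    obtain ⟨h0, s, -, hs, -⟩ := hx
    have hs' : ∀ v, v ∉ s₀ ∪ s → x v = 0 := fun v hv =>
      hs v fun h => hv (Finset.mem_union_right _ h)
    have e1 : push φ x w = a x + ∑ v ∈ s \ s₀, if φ v = w then x v else 0 := by
      rw [push_eq_sum φ hs', ← Finset.union_sdiff_self_eq_union,
        Finset.sum_union Finset.disjoint_sdiff]
    have e2 : ∑ v ∈ s₀, x v + ∑ v ∈ s \ s₀, x v ≤ 1 := by
      rw [← Finset.sum_union Finset.disjoint_sdiff]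
      exact hsum _
    have e3 : ∑ v ∈ s \ s₀, (if φ v = w then x v else 0) ≤ ∑ v ∈ s \ s₀, x v :=
      Finset.sum_le_sum fun v _ => by split_ifs <;> simp [h0]
    have e4 : 0 ≤ ∑ v ∈ s \ s₀, (if φ v = w then x v else 0) :=
      Finset.sum_nonneg fun v _ => by split_ifs <;> simp [h0]
    constructor
    · rw [e1]; linarith
    · rw [e1]; simp only [b]; linarith
  have hp : push φ x₀ w = a x₀ := push_eq_sum φ hs₀ w
  refine tendsto_of_tendsto_of_tendsto_of_le_of_le' (g := a) (h := b) ?_ ?_ ?_ ?_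
  · beta_reduce; rw [hp]; exact ha.continuousWithinAt
  · beta_reduce; rw [hp, ← hab]; exact hb.continuousWithinAt
  · filter_upwards [self_mem_nhdsWithin] with x hx using (key x hx).1
  · filter_upwards [self_mem_nhdsWithin] with x hx using (key x hx).2

theorem mem_faces_of_pos {K : ASC V} {x : V → ℝ} (hx : x ∈ K.space) {σ : Finset V}
    (hσ : σ.Nonempty) (hpos : ∀ v ∈ σ, 0 < x v) : σ ∈ K.faces := by
  obtain ⟨-, s, hs, hs0, -⟩ := hx
  refine K.down_closed hs (fun v hv => ?_) hσ
  by_contra h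
  exact (hpos v hv).ne' (hs0 v h)

theorem exists_pos_of_mem_space {K : ASC V} {x : V → ℝ} (hx : x ∈ K.space) : ∃ v, 0 < x v := by
  obtain ⟨h0, s, -, -, h1⟩ := hx
  by_contra! h
  have : ∑ v ∈ s, x v ≤ 0 := Finset.sum_nonpos fun v _ => h v
  linarith

/-- The part of the realization of `X` lying over the open star of `σ`. -/
def overStar (X : ASC V) (φ : V → W) (σ : Finset W) : Set (V → ℝ) :=
  {x | x ∈ X.space ∧ ∀ w ∈ σ, 0 < push φ x w}

/-- The part of the realization of `X` lying over the barycenter of `σ`. -/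
def overBarycenter (X : ASC V) (φ : V → W) (σ : Finset W) : Set (V → ℝ) :=
  {x | x ∈ X.space ∧ push φ x = fun w => if w ∈ σ then (σ.card : ℝ)⁻¹ else 0}

/-- The retraction of the part over the open star of `σ` to the part over its barycenter. -/
noncomputable def toBarycenter (φ : V → W) (σ : Finset W) (x : V → ℝ) : V → ℝ :=
  fun v => if φ v ∈ σ then x v / (σ.card * push φ x (φ v)) else 0

theorem continuousOn_toBarycenter (X : ASC V) (φ : V → W) (σ : Finset W) :
    ContinuousOn (toBarycenter φ σ) (X.overStar φ σ) := by
  refine continuousOn_pi.2 fun v => ?_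
  unfold toBarycenter
  by_cases hv : φ v ∈ σ
  · simp only [hv, if_true]
    have hc : ContinuousOn (fun x : V → ℝ => push φ x (φ v)) (X.overStar φ σ) :=
      (continuousOn_pi.1 (continuousOn_push X φ) (φ v)).mono fun x hx => hx.1
    refine ContinuousOn.div (by fun_prop) (by fun_prop) fun x hx => ?_
    have : 0 < σ.card := Finset.card_pos.2 ⟨_, hv⟩
    have := hx.2 _ hv
    positivity
  · simp only [hv, if_false]
    exact continuousOn_const

section toBarycenter

variable {X : ASC V} {φ : V → W} {σ : Finset W} {x : V → ℝ}

theorem toBarycenter_eq_zero {v : V} (h : x v = 0) : toBarycenter φ σ x v = 0 := by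
  simp [toBarycenter, h]

theorem toBarycenter_nonneg (hx : x ∈ X.space) (v : V) : 0 ≤ toBarycenter φ σ x v := by
  unfold toBarycenter
  have h0 := hx.1
  have := h0 v
  have := push_nonneg φ h0 (φ v)
  split_ifs <;> positivity

theorem push_toBarycenter (hx : x ∈ X.overStar φ σ) :
    push φ (toBarycenter φ σ x) = fun w => if w ∈ σ then (σ.card : ℝ)⁻¹ else 0 := by
  obtain ⟨⟨h0, s, hsX, hs, h1⟩, hpos⟩ := hx
  have hs' : ∀ v, v ∉ s → toBarycenter φ σ x v = 0 := fun v hv => toBarycenter_eq_zero (hs v hv)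
  funext w
  rw [push_eq_sum φ hs']
  split_ifs with hw
  · have hp := (hpos w hw).ne'
    have hc : (σ.card : ℝ) ≠ 0 := by
      have : 0 < σ.card := Finset.card_pos.2 ⟨_, hw⟩
      positivity
    have : ∀ v ∈ s, (if φ v = w then toBarycenter φ σ x v else 0) =
        (if φ v = w then x v else 0) * (σ.card * push φ x w)⁻¹ := by
      intro v _
      split_ifs with h
      · subst h
        simp [toBarycenter, hw, div_eq_mul_inv]
      · simp
    rw [Finset.sum_congr rfl this, ← Finset.sum_mul, ← push_eq_sum φ hs]
    field_simp
  · refine Finset.sum_eq_zero fun v _ => ?_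
    split_ifs with h
    · subst h
      simp [toBarycenter, hw]
    · rfl

theorem sum_toBarycenter (hσ : σ.Nonempty) (hx : x ∈ X.overStar φ σ) {s : Finset V}
    (hs : ∀ v, v ∉ s → x v = 0) : ∑ v ∈ s, toBarycenter φ σ x v = 1 := by
  have hs' : ∀ v, v ∉ s → toBarycenter φ σ x v = 0 := fun v hv => toBarycenter_eq_zero (hs v hv)
  have hc : (σ.card : ℝ) ≠ 0 := by
    have : 0 < σ.card := Finset.card_pos.2 hσ
    positivity
  have h := sum_push φ hs' σ
  rw [push_toBarycenter hx] at h
  have h2 : ∑ v ∈ s, toBarycenter φ σ x v =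
      ∑ v ∈ s, if φ v ∈ σ then toBarycenter φ σ x v else 0 :=
    Finset.sum_congr rfl fun v _ => by unfold toBarycenter; split_ifs <;> rfl
  rw [h2, ← h, Finset.sum_congr rfl (g := fun _ => (σ.card : ℝ)⁻¹) fun w hw => by simp [hw]]
  simp [hc]

theorem toBarycenter_mem (hσ : σ.Nonempty) (hx : x ∈ X.overStar φ σ) :
    toBarycenter φ σ x ∈ X.overBarycenter φ σ := by
  have hx' := hx
  obtain ⟨⟨h0, s, hsX, hs, h1⟩, hpos⟩ := hx'
  exact ⟨⟨toBarycenter_nonneg hx.1, s, hsX, fun v hv => toBarycenter_eq_zero (hs v hv),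
    sum_toBarycenter hσ hx hs⟩, push_toBarycenter hx⟩

theorem segment_toBarycenter_mem (hσ : σ.Nonempty) (hx : x ∈ X.overStar φ σ) {t : ℝ}
    (ht : t ∈ Set.Icc (0 : ℝ) 1) :
    (1 - t) • toBarycenter φ σ x + t • x ∈ X.overStar φ σ := by
  have hx' := hx
  obtain ⟨⟨h0, s, hsX, hs, h1⟩, hpos⟩ := hx'
  have ht0 := ht.1
  have ht1 : 0 ≤ 1 - t := sub_nonneg.2 ht.2
  have hs' : ∀ v, v ∉ s → toBarycenter φ σ x v = 0 := fun v hv => toBarycenter_eq_zero (hs v hv)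
  have hs'' : ∀ v, v ∉ s → ((1 - t) • toBarycenter φ σ x + t • x) v = 0 := fun v hv => by
    simp [hs v hv, hs' v hv]
  refine ⟨⟨fun v => ?_, s, hsX, hs'', ?_⟩, fun w hw => ?_⟩
  · have := h0 v
    have := toBarycenter_nonneg (φ := φ) (σ := σ) hx.1 v
    simp only [Pi.add_apply, Pi.smul_apply, smul_eq_mul]
    positivity
  · simp only [Pi.add_apply, Pi.smul_apply, smul_eq_mul, Finset.sum_add_distrib,
      ← Finset.mul_sum, sum_toBarycenter hσ hx hs, h1]
    ring
  · have e : push φ ((1 - t) • toBarycenter φ σ x + t • x) w =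
        (1 - t) * push φ (toBarycenter φ σ x) w + t * push φ x w := by
      rw [push_eq_sum φ hs'', push_eq_sum φ hs', push_eq_sum φ hs, Finset.mul_sum, Finset.mul_sum,
        ← Finset.sum_add_distrib]
      refine Finset.sum_congr rfl fun v _ => ?_
      split_ifs <;> simp
    rw [e, push_toBarycenter hx]
    simp only [hw, if_true]
    have hp := hpos w hw
    have hc : (0 : ℝ) < (σ.card : ℝ)⁻¹ := by
      have : 0 < σ.card := Finset.card_pos.2 hσ
      positivity
    rcases ht0.eq_or_lt with rfl | h
    · simpa using Finset.card_pos.2 hσ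
    · have : 0 ≤ (1 - t) * (σ.card : ℝ)⁻¹ := by positivity
      have : 0 < t * push φ x w := by positivity
      linarith

end toBarycenter

end ASC

section Extension

open Set Metric

theorem exists_glue_continuousOn {α E : Type*} [TopologicalSpace α] [TopologicalSpace E]
    {s t : Set α} (hs : IsClosed s) (ht : IsClosed t) {f g : α → E} (hf : ContinuousOn f s)
    (hg : ContinuousOn g t) (hfg : ∀ x ∈ s, x ∈ t → f x = g x) :
    ∃ F : α → E, ContinuousOn F (s ∪ t) ∧ EqOn F f s ∧ EqOn F g t := by
  classical
  have h1 : EqOn (s.piecewise f g) f s := piecewise_eqOn s f g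
  have h2 : EqOn (s.piecewise f g) g t := by
    intro x hx
    by_cases h : x ∈ s
    · rw [h1 h, hfg x h hx]
    · simp [h]
  exact ⟨s.piecewise f g,
    (hf.congr h1).union_of_isClosed (hg.congr h2) hs ht, h1, h2⟩

theorem exists_abs_eq_norm_of_norm_pos {ι : Type*} [Fintype ι] {x : ι → ℝ} (hx : 0 < ‖x‖) :
    ∃ i, |x i| = ‖x‖ := by
  by_contra! h
  exact lt_irrefl _ ((pi_norm_lt_iff hx).2 fun i => (norm_le_pi_norm x i).lt_of_ne (h i))

/-- Every continuous map from the boundary of the cube `[-1, 1]^k` to `A` extends to the cube. -/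
def SphereExtendable {E : Type*} [TopologicalSpace E] (A : Set E) (k : ℕ) : Prop :=
  ∀ g : (Fin k → ℝ) → E, ContinuousOn g (sphere 0 1) → MapsTo g (sphere 0 1) A →
    ∃ G : (Fin k → ℝ) → E, ContinuousOn G (closedBall 0 1) ∧ MapsTo G (closedBall 0 1) A ∧
      EqOn G g (sphere 0 1)

theorem SphereExtendable.of_deformation {E : Type*} [TopologicalSpace E] {A B : Set E} {k : ℕ}
    (hB : SphereExtendable B k) (hBA : B ⊆ A) (h : ℝ × E → E)
    (hc : ContinuousOn h (Icc 0 1 ×ˢ A)) (hA : ∀ t ∈ Icc (0 : ℝ) 1, ∀ x ∈ A, h (t, x) ∈ A)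
    (h0 : ∀ x ∈ A, h (0, x) ∈ B) (h1 : ∀ x ∈ A, h (1, x) = x) : SphereExtendable A k := by
  intro g hg hgA
  obtain ⟨G, hG, hGB, hGg⟩ := hB (fun x => h (0, g x))
    (hc.comp (continuousOn_const.prodMk hg) fun x hx => ⟨by simp, hgA hx⟩)
    (fun x hx => h0 _ (hgA hx))
  have hn : ∀ x : Fin k → ℝ, x ≠ 0 → ‖x‖⁻¹ • x ∈ sphere (0 : Fin k → ℝ) 1 := fun x hx => by
    simp [norm_smul, hx]
  have hne : ∀ x ∈ {x : Fin k → ℝ | 1 / 2 ≤ ‖x‖ ∧ ‖x‖ ≤ 1}, ‖x‖ ≠ 0 := fun x hx h => by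
    have := hx.1
    norm_num [h] at this
  have hcg : ContinuousOn (fun x : Fin k → ℝ => g (‖x‖⁻¹ • x))
      {x | 1 / 2 ≤ ‖x‖ ∧ ‖x‖ ≤ 1} :=
    hg.comp (ContinuousOn.smul (continuous_norm.continuousOn.inv₀ hne) continuousOn_id)
      fun x hx => hn x (norm_ne_zero_iff.1 (hne x hx))
  obtain ⟨F, hF, hF1, hF2⟩ := exists_glue_continuousOn
    (s := closedBall (0 : Fin k → ℝ) (1 / 2)) (t := {x | 1 / 2 ≤ ‖x‖ ∧ ‖x‖ ≤ 1})
    (f := fun x => G ((2 : ℝ) • x)) (g := fun x => h (2 * ‖x‖ - 1, g (‖x‖⁻¹ • x)))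
    isClosed_closedBall
    ((isClosed_le continuous_const continuous_norm).inter
      (isClosed_le continuous_norm continuous_const))
    (hG.comp (by fun_prop) fun x hx => by
      simp only [mem_closedBall_zero_iff, norm_smul] at hx ⊢; norm_num; linarith)
    (hc.comp (ContinuousOn.prodMk (by fun_prop) hcg) fun x hx =>
      ⟨⟨by linarith [hx.1], by linarith [hx.2]⟩,
        hgA (hn x (norm_ne_zero_iff.1 (hne x hx)))⟩)
    (fun x hx hx' => by
      have e : ‖x‖ = 1 / 2 := le_antisymm (by simpa using hx) hx'.1
      have e2 : (2 : ℝ) • x ∈ sphere (0 : Fin k → ℝ) 1 := by simp [norm_smul, e]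
      simp only [e]
      norm_num
      exact hGg e2)
  refine ⟨F, hF.mono fun x hx => ?_, fun x hx => ?_, fun x hx => ?_⟩
  · rcases le_total ‖x‖ (1 / 2) with h | h
    · exact Or.inl (by simpa using h)
    · exact Or.inr ⟨h, by simpa using hx⟩
  · rcases le_total ‖x‖ (1 / 2) with h | h
    · rw [hF1 (by simpa using h)]
      refine hBA (hGB ?_)
      simp only [mem_closedBall_zero_iff, norm_smul]; norm_num; linarith
    · rw [mem_closedBall_zero_iff] at hx
      rw [hF2 ⟨h, hx⟩]
      exact hA _ ⟨by linarith, by linarith⟩ _ (hgA (hn x (norm_ne_zero_iff.1 (hne x ⟨h, hx⟩))))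
  · have e : ‖x‖ = 1 := by simpa using hx
    rw [hF2 ⟨by norm_num [e], e.le⟩]
    simp only [e]
    norm_num
    exact h1 _ (hgA hx)

end Extension

section HomotopyGroups

open Set Metric unitInterval

/-- The affine map from `[-1, 1]^m` to the unit cube, clamped to all of `ℝ^m`. -/
noncomputable def toUnitCube {m : ℕ} (u : Fin m → ℝ) : Fin m → I :=
  fun i => projIcc 0 1 zero_le_one ((u i + 1) / 2)

theorem continuous_toUnitCube {m : ℕ} : Continuous (toUnitCube (m := m)) :=
  continuous_pi fun i => continuous_projIcc.comp (by fun_prop)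

theorem toUnitCube_mem_boundary {m : ℕ} {u : Fin m → ℝ} (hu : ‖u‖ = 1) :
    toUnitCube u ∈ Cube.boundary (Fin m) := by
  obtain ⟨i, hi⟩ := exists_abs_eq_norm_of_norm_pos (x := u) (by simp [hu])
  rw [hu] at hi
  refine ⟨i, ?_⟩
  rcases (abs_eq zero_le_one).1 hi with h | h
  · right; simp [toUnitCube, h]
  · left; simp [toUnitCube, h]

/-- The affine map from the unit cube to `[-1, 1]^m`. -/
def ofUnitCube {m : ℕ} (y : Fin m → I) : Fin m → ℝ := fun i => 2 * y i - 1

theorem continuous_ofUnitCube {m : ℕ} : Continuous (ofUnitCube (m := m)) :=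
  continuous_pi fun i => by unfold ofUnitCube; fun_prop

theorem norm_ofUnitCube_le {m : ℕ} (y : Fin m → I) : ‖ofUnitCube y‖ ≤ 1 := by
  rw [pi_norm_le_iff_of_nonneg zero_le_one]
  intro i
  rw [Real.norm_eq_abs, abs_le]
  have := (y i).2.1
  have := (y i).2.2
  constructor <;> simp only [ofUnitCube] <;> linarith

theorem toUnitCube_ofUnitCube {m : ℕ} (y : Fin m → I) : toUnitCube (ofUnitCube y) = y := by
  funext i
  have : ((2 * (y i : ℝ) - 1) + 1) / 2 = y i := by ring
  simp [toUnitCube, ofUnitCube]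

theorem ofUnitCube_toUnitCube {m : ℕ} {u : Fin m → ℝ} (hu : ‖u‖ ≤ 1) :
    ofUnitCube (toUnitCube u) = u := by
  funext i
  have := abs_le.1 ((norm_le_pi_norm u i).trans hu)
  have h : (u i + 1) / 2 ∈ Icc (0 : ℝ) 1 := ⟨by linarith [this.1], by linarith [this.2]⟩
  simp only [toUnitCube, ofUnitCube]
  rw [projIcc_of_mem _ h]
  ring

theorem norm_ofUnitCube_of_mem_boundary {m : ℕ} {y : Fin m → I}
    (hy : y ∈ Cube.boundary (Fin m)) : ‖ofUnitCube y‖ = 1 := by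
  refine le_antisymm (norm_ofUnitCube_le y) ?_
  obtain ⟨i, hi⟩ := hy
  refine le_trans (le_of_eq ?_) (norm_le_pi_norm _ i)
  rcases hi with h | h <;> (simp [ofUnitCube, h]; try norm_num)

theorem norm_finCons {m : ℕ} (t : ℝ) (u : Fin m → ℝ) :
    ‖(Fin.cons t u : Fin (m + 1) → ℝ)‖ = max |t| ‖u‖ := by
  refine le_antisymm ?_ (max_le ?_ ?_)
  · rw [pi_norm_le_iff_of_nonneg (by positivity)]
    intro i
    refine Fin.cases ?_ (fun j => ?_) i
    · simp
    · simpa using Or.inr (norm_le_pi_norm u j)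
  · simpa using norm_le_pi_norm (Fin.cons t u : Fin (m + 1) → ℝ) 0
  · rw [pi_norm_le_iff_of_nonneg (norm_nonneg _)]
    intro j
    simpa using norm_le_pi_norm (Fin.cons t u : Fin (m + 1) → ℝ) j.succ

theorem SphereExtendable.subsingleton_homotopyGroup {E : Type*} [TopologicalSpace E] {A : Set E}
    {m : ℕ} (hA : SphereExtendable A (m + 1)) (x : A) :
    Subsingleton (HomotopyGroup (Fin m) A x) := by
  refine ⟨fun p q => Quotient.inductionOn₂ p q fun a b => Quotient.sound ?_⟩
  have hcl : ∀ c : ℝ, IsClosed ({z : Fin (m + 1) → ℝ | z 0 = c}) := fun c =>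
    isClosed_eq (continuous_apply 0) continuous_const
  have hct : Continuous fun z : Fin (m + 1) → ℝ => (Fin.tail z : Fin m → ℝ) :=
    continuous_pi fun i => continuous_apply _
  have hloop : ∀ c : GenLoop (Fin m) A x,
      Continuous fun z : Fin (m + 1) → ℝ => (c (toUnitCube (Fin.tail z)) : E) := fun c =>
    continuous_subtype_val.comp (c.1.continuous.comp (continuous_toUnitCube.comp hct))
  have hbd : ∀ (c : GenLoop (Fin m) A x) (z : Fin (m + 1) → ℝ), ‖(Fin.tail z : Fin m → ℝ)‖ = 1 →
      c (toUnitCube (Fin.tail z)) = x := fun c z hz => c.2 _ (toUnitCube_mem_boundary hz)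
  obtain ⟨F, hF, hFa, hFb⟩ := exists_glue_continuousOn (hcl (-1)) (hcl 1)
    (hloop a).continuousOn (hloop b).continuousOn
    (fun z h h' => by have := (show z 0 = -1 from h).symm.trans h'; norm_num at this)
  obtain ⟨F', hF', hF'1, hF'2⟩ := exists_glue_continuousOn ((hcl (-1)).union (hcl 1))
    (isClosed_eq (continuous_norm.comp hct) (continuous_const (y := (1 : ℝ)))) hF
    (continuousOn_const (c := (x : E))) (fun z h h' => by
      rcases h with h | h
      · exact (hFa h).trans (congrArg Subtype.val (hbd a z h'))
      · exact (hFb h).trans (congrArg Subtype.val (hbd b z h')))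
  have hsph : ∀ z ∈ sphere (0 : Fin (m + 1) → ℝ) 1,
      (z 0 = -1 ∨ z 0 = 1) ∨ ‖(Fin.tail z : Fin m → ℝ)‖ = 1 := by
    intro z hz
    rw [mem_sphere_zero_iff_norm, ← Fin.cons_self_tail z, norm_finCons] at hz
    rcases max_choice |z 0| ‖(Fin.tail z : Fin m → ℝ)‖ with h | h
    · rw [h] at hz
      exact Or.inl ((abs_eq zero_le_one).1 hz).symm
    · rw [h] at hz
      exact Or.inr hz
  obtain ⟨G, hG, hGA, hGF⟩ := hA F' (hF'.mono hsph) (fun z hz => by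
    rcases hsph z hz with h | h
    · rw [hF'1 h]
      rcases h with h | h
      · rw [hFa h]; exact Subtype.coe_prop _
      · rw [hFb h]; exact Subtype.coe_prop _
    · rw [hF'2 h]; exact x.2)
  let c : I × (Fin m → I) → Fin (m + 1) → ℝ := fun p => Fin.cons (2 * (p.1 : ℝ) - 1) (ofUnitCube p.2)
  have hc : Continuous c := Continuous.finCons (by fun_prop) (continuous_ofUnitCube.comp continuous_snd)
  have habs : ∀ t : I, |2 * (t : ℝ) - 1| ≤ 1 := fun t =>
    abs_le.2 ⟨by linarith [t.2.1], by linarith [t.2.2]⟩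
  have hcb : ∀ p, c p ∈ closedBall (0 : Fin (m + 1) → ℝ) 1 := fun p => by
    rw [mem_closedBall_zero_iff, norm_finCons]
    exact max_le (habs _) (norm_ofUnitCube_le _)
  have hcs : ∀ t : I, t = 0 ∨ t = 1 → ∀ y, c (t, y) ∈ sphere (0 : Fin (m + 1) → ℝ) 1 := by
    intro t ht y
    rw [mem_sphere_zero_iff_norm, norm_finCons]
    have : |2 * (t : ℝ) - 1| = 1 := by rcases ht with rfl | rfl <;> norm_num
    rw [this]
    exact max_eq_left (norm_ofUnitCube_le _)
  refine ⟨{ toFun := fun p => ⟨G (c p), hGA (hcb p)⟩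
            continuous_toFun := (hG.comp_continuous hc hcb).subtype_mk _
            map_zero_left := fun y => ?_
            map_one_left := fun y => ?_
            prop' := fun t y hy => ?_ }⟩
  · apply Subtype.ext
    have h0 : c (0, y) 0 = -1 := by simp [c]
    change G (c (0, y)) = _
    rw [hGF (hcs 0 (Or.inl rfl) y), hF'1 (Or.inl h0), hFa h0]
    simp [c, toUnitCube_ofUnitCube]
  · apply Subtype.ext
    have h0 : c (1, y) 0 = 1 := by simp [c]; norm_num
    change G (c (1, y)) = _
    rw [hGF (hcs 1 (Or.inr rfl) y), hF'1 (Or.inr h0), hFb h0]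
    simp [c, toUnitCube_ofUnitCube]
  · apply Subtype.ext
    have h1 : ‖(Fin.tail (c (t, y)) : Fin m → ℝ)‖ = 1 := by
      simpa [c] using norm_ofUnitCube_of_mem_boundary hy
    have h2 : c (t, y) ∈ sphere (0 : Fin (m + 1) → ℝ) 1 := by
      rw [mem_sphere_zero_iff_norm, norm_finCons, norm_ofUnitCube_of_mem_boundary hy]
      exact max_eq_right (habs _)
    change G (c (t, y)) = a.1 y
    rw [hGF h2, hF'2 h1]
    exact congrArg Subtype.val (a.2 y hy).symm

end HomotopyGroups

section Collapse

open Set Metric unitInterval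

/-- The scaling factor of `collapse` at radius `r`. -/
noncomputable def collapseScale (r : ℝ) : ℝ := min 1 (3 * (1 - r)) / max r (1 / 3)

/-- The height of `collapse` at radius `r`. -/
noncomputable def collapseHeight (r : ℝ) : ℝ := max (-1) (min 1 (3 - 6 * r))

theorem collapse_of_le {r : ℝ} (hr : r ≤ 1 / 3) : collapseScale r = 3 ∧ collapseHeight r = 1 := by
  unfold collapseScale collapseHeight
  rw [min_eq_left (by linarith), max_eq_right hr, min_eq_left (by linarith),
    max_eq_right (by linarith)]
  norm_num

theorem collapse_of_le_of_le {r : ℝ} (hr : 1 / 3 ≤ r) (hr' : r ≤ 2 / 3) :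
    collapseScale r = 1 / r ∧ collapseHeight r = 3 - 6 * r := by
  unfold collapseScale collapseHeight
  rw [min_eq_left (by linarith), max_eq_left hr, min_eq_right (by linarith),
    max_eq_right (by linarith)]
  exact ⟨rfl, rfl⟩

theorem collapse_of_ge {r : ℝ} (hr : 2 / 3 ≤ r) :
    collapseScale r = 3 * (1 - r) / r ∧ collapseHeight r = -1 := by
  unfold collapseScale collapseHeight
  rw [min_eq_right (by linarith), max_eq_left (by linarith), min_eq_right (by linarith),
    max_eq_left (by linarith)]
  exact ⟨rfl, rfl⟩

theorem collapseScale_pos {r : ℝ} (hr : r < 1) : 0 < collapseScale r :=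
  div_pos (lt_min one_pos (by linarith)) (lt_max_of_lt_right (by norm_num))

theorem collapseScale_nonneg {r : ℝ} (hr : r ≤ 1) : 0 ≤ collapseScale r :=
  div_nonneg (le_min zero_le_one (by linarith)) (le_max_of_le_right (by norm_num))

theorem collapse_max (r : ℝ) :
    max |collapseHeight r| (collapseScale r * r) = 1 := by
  rcases le_total r (1 / 3) with h | h
  · rw [(collapse_of_le h).1, (collapse_of_le h).2, abs_one, max_eq_left (by linarith)]
  rcases le_total r (2 / 3) with h' | h'
  · rw [(collapse_of_le_of_le h h').1, (collapse_of_le_of_le h h').2,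
      one_div_mul_cancel (by linarith), max_eq_right (abs_le.2 ⟨by linarith, by linarith⟩)]
  · rw [(collapse_of_ge h').1, (collapse_of_ge h').2, div_mul_cancel₀ _ (by linarith), abs_neg,
      abs_one, max_eq_left (by linarith)]

theorem collapse_injective {r r' : ℝ} (hr : collapseHeight r = collapseHeight r')
    (hr' : collapseScale r * r = collapseScale r' * r') : r = r' := by
  have key : ∀ r : ℝ,
      (collapseHeight r = 1 ∧ collapseScale r * r = 3 * r ∧ r ≤ 1 / 3) ∨
      (collapseHeight r = 3 - 6 * r ∧ collapseScale r * r = 1 ∧ 1 / 3 ≤ r ∧ r ≤ 2 / 3) ∨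
      (collapseHeight r = -1 ∧ collapseScale r * r = 3 * (1 - r) ∧ 2 / 3 ≤ r) := by
    intro r
    rcases le_total r (1 / 3) with h | h
    · exact Or.inl ⟨(collapse_of_le h).2, by rw [(collapse_of_le h).1], h⟩
    rcases le_total r (2 / 3) with h' | h'
    · exact Or.inr (Or.inl ⟨(collapse_of_le_of_le h h').2,
        by rw [(collapse_of_le_of_le h h').1, one_div_mul_cancel (by linarith)], h, h'⟩)
    · exact Or.inr (Or.inr ⟨(collapse_of_ge h').2,
        by rw [(collapse_of_ge h').1, div_mul_cancel₀ _ (by linarith)], h'⟩)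
  rcases key r with ⟨a, b, c⟩ | ⟨a, b, c⟩ | ⟨a, b, c⟩ <;>
  rcases key r' with ⟨a', b', c'⟩ | ⟨a', b', c'⟩ | ⟨a', b', c'⟩ <;>
  rw [a, a'] at hr <;> rw [b, b'] at hr' <;> linarith

variable {m : ℕ}

/-- The bottom center of the cube `[-1, 1]^(m+1)`. -/
def bottomCenter (m : ℕ) : Fin (m + 1) → ℝ := Fin.cons (-1) 0

/-- A map from `[-1, 1]^m` onto the boundary of `[-1, 1]^(m+1)` which collapses the boundary of
its source to the point `bottomCenter` and is injective elsewhere. -/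
noncomputable def collapse (u : Fin m → ℝ) : Fin (m + 1) → ℝ :=
  Fin.cons (collapseHeight ‖u‖) (collapseScale ‖u‖ • u)

theorem norm_bottomCenter : ‖bottomCenter m‖ = 1 := by
  simp [bottomCenter, norm_finCons]

theorem continuous_collapse : Continuous (collapse (m := m)) := by
  have h : Continuous fun r : ℝ => collapseScale r :=
    Continuous.div (by fun_prop) (by fun_prop) fun r => (lt_max_of_lt_right (by norm_num)).ne'
  have h' : Continuous fun r : ℝ => collapseHeight r := by unfold collapseHeight; fun_prop
  exact Continuous.finCons (h'.comp continuous_norm) ((h.comp continuous_norm).smul continuous_id)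

theorem norm_collapseScale_smul {u : Fin m → ℝ} (hu : ‖u‖ ≤ 1) :
    ‖collapseScale ‖u‖ • u‖ = collapseScale ‖u‖ * ‖u‖ := by
  rw [norm_smul, Real.norm_of_nonneg (collapseScale_nonneg hu)]

theorem norm_collapse {u : Fin m → ℝ} (hu : ‖u‖ ≤ 1) : ‖collapse u‖ = 1 := by
  rw [collapse, norm_finCons, norm_collapseScale_smul hu, collapse_max]

theorem collapse_of_norm_eq_one {u : Fin m → ℝ} (hu : ‖u‖ = 1) : collapse u = bottomCenter m := by
  have h := collapse_of_ge (r := ‖u‖) (by rw [hu]; norm_num)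
  rw [collapse, h.1, h.2, hu]
  simp [bottomCenter]

theorem norm_eq_one_of_collapse_eq {u : Fin m → ℝ} (hu : ‖u‖ ≤ 1)
    (h : collapse u = bottomCenter m) : ‖u‖ = 1 := by
  obtain ⟨h1, h2⟩ := Fin.cons_injective2 h
  have h3 := norm_collapseScale_smul hu
  rw [h2, norm_zero] at h3
  have h4 := collapse_of_ge (r := 1) (by norm_num)
  refine collapse_injective (h1.trans h4.2.symm) ?_
  rw [← h3, h4.1]
  norm_num

theorem eq_or_norm_eq_one_of_collapse_eq {u u' : Fin m → ℝ} (hu : ‖u‖ ≤ 1) (hu' : ‖u'‖ ≤ 1)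
    (h : collapse u = collapse u') : u = u' ∨ (‖u‖ = 1 ∧ ‖u'‖ = 1) := by
  obtain ⟨h1, h2⟩ := Fin.cons_injective2 h
  have h3 := congrArg norm h2
  rw [norm_collapseScale_smul hu, norm_collapseScale_smul hu'] at h3
  have h4 := collapse_injective h1 h3
  rcases hu.lt_or_eq with h5 | h5
  · left
    rw [← h4] at h2
    exact smul_right_injective _ (collapseScale_pos h5).ne' h2
  · exact Or.inr ⟨h5, h4 ▸ h5⟩

theorem exists_collapse_eq {y : Fin (m + 1) → ℝ} (hy : ‖y‖ = 1) (hb : y ≠ bottomCenter m) :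
    ∃ u : Fin m → ℝ, ‖u‖ ≤ 1 ∧ collapse u = y := by
  obtain ⟨t, v, rfl⟩ : ∃ t v, y = Fin.cons t v := ⟨y 0, Fin.tail y, (Fin.cons_self_tail y).symm⟩
  rw [norm_finCons] at hy
  have ht : |t| ≤ 1 := hy ▸ le_max_left _ _
  have hv : ‖v‖ ≤ 1 := hy ▸ le_max_right _ _
  have hv0 := norm_nonneg v
  have build : ∀ c r : ℝ, 0 ≤ c → c * ‖v‖ = r → r ≤ 1 → collapseHeight r = t →
      collapseScale r * c = 1 → ∃ u : Fin m → ℝ, ‖u‖ ≤ 1 ∧ collapse u = Fin.cons t v := by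
    intro c r hc hr hr1 h1 h2
    have e : ‖c • v‖ = r := by rw [norm_smul, Real.norm_of_nonneg hc, hr]
    refine ⟨c • v, e.le.trans hr1, ?_⟩
    rw [collapse, e, h1, smul_smul, h2, one_smul]
  by_cases h1 : t = 1
  · have h := collapse_of_le (r := 1 / 3 * ‖v‖) (by linarith)
    exact build (1 / 3) _ (by norm_num) rfl (by linarith) (h.2.trans h1.symm) (by rw [h.1]; norm_num)
  by_cases h2 : t = -1
  · have hvne : ‖v‖ ≠ 0 := by
      intro h0
      apply hb
      rw [norm_eq_zero.1 h0, h2, bottomCenter]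
    have h := collapse_of_ge (r := 1 - ‖v‖ / 3) (by linarith)
    have hr : (1 - ‖v‖ / 3) ≠ 0 := by linarith
    refine build ((1 - ‖v‖ / 3) / ‖v‖) _ (div_nonneg (by linarith) hv0) (div_mul_cancel₀ _ hvne)
      (by linarith) (h.2.trans h2.symm) ?_
    rw [h.1, div_mul_div_cancel₀ hr]
    field_simp
    ring
  · have hlt : |t| < 1 := lt_of_le_of_ne ht fun h => ((abs_eq zero_le_one).1 h).elim h1 h2
    have hv1 : ‖v‖ = 1 := by
      rcases max_choice |t| ‖v‖ with h | h
      · exact absurd (h.symm.trans hy) hlt.ne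
      · exact h.symm.trans hy
    have := abs_lt.1 hlt
    have h := collapse_of_le_of_le (r := (3 - t) / 6) (by linarith [this.2]) (by linarith [this.1])
    refine build ((3 - t) / 6) _ (by linarith [this.2]) (by rw [hv1, mul_one])
      (by linarith [this.1]) (h.2.trans (by ring)) ?_
    rw [h.1]
    exact one_div_mul_cancel (by linarith [this.2])

theorem sphereExtendable_of_subsingleton_homotopyGroup {Z E : Type} [TopologicalSpace Z]
    [TopologicalSpace E] [Nonempty Z] (hZ : ∀ z : Z, Subsingleton (HomotopyGroup (Fin m) Z z))
    {i : Z → E} (hi : Topology.IsInducing i) : SphereExtendable (range i) (m + 1) := by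
  intro g hg hgi
  have hgi' : ∀ x, x ∈ sphere (0 : Fin (m + 1) → ℝ) 1 → ∃ z, i z = g x := fun x hx => hgi hx
  choose! lift hlift using hgi'
  set z := lift (bottomCenter m) with hz
  have hmem : ∀ y : Fin m → I, collapse (ofUnitCube y) ∈ sphere (0 : Fin (m + 1) → ℝ) 1 :=
    fun y => mem_sphere_zero_iff_norm.2 (norm_collapse (norm_ofUnitCube_le y))
  have hbc : bottomCenter m ∈ sphere (0 : Fin (m + 1) → ℝ) 1 :=
    mem_sphere_zero_iff_norm.2 norm_bottomCenter
  have hcof : Continuous fun y : Fin m → I => collapse (ofUnitCube y) :=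
    continuous_collapse.comp continuous_ofUnitCube
  have hcl : Continuous fun y : Fin m → I => lift (collapse (ofUnitCube y)) := by
    rw [hi.continuous_iff]
    exact (hg.comp_continuous hcof hmem).congr fun y => (hlift _ (hmem y)).symm
  let loop : GenLoop (Fin m) Z z := ⟨⟨_, hcl⟩, fun y hy => by
    change lift (collapse (ofUnitCube y)) = z
    rw [collapse_of_norm_eq_one (norm_ofUnitCube_of_mem_boundary hy)]⟩
  obtain ⟨H⟩ : GenLoop.Homotopic loop GenLoop.const :=
    Quotient.exact ((hZ z).elim (⟦loop⟧ : HomotopyGroup (Fin m) Z z) ⟦GenLoop.const⟧)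
  have H0 : ∀ y, H (0, y) = lift (collapse (ofUnitCube y)) := fun y => H.apply_zero y
  have H1 : ∀ y, H (1, y) = z := fun y => H.apply_one y
  have Hb : ∀ s y, ‖ofUnitCube y‖ = 1 → H (s, y) = z := fun s y hy => by
    have hy' : y ∈ Cube.boundary (Fin m) := by
      have := toUnitCube_mem_boundary hy
      rwa [toUnitCube_ofUnitCube] at this
    exact (H.eq_fst s hy').trans (loop.2 y hy')
  let P : (I × (Fin m → I)) ⊕ I → closedBall (0 : Fin (m + 1) → ℝ) 1 :=
    Sum.elim
      (fun q => ⟨(1 - (q.1 : ℝ)) • collapse (ofUnitCube q.2), by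
        rw [mem_closedBall_zero_iff, norm_smul, norm_collapse (norm_ofUnitCube_le _), mul_one,
          Real.norm_of_nonneg (by linarith [q.1.2.2])]
        linarith [q.1.2.1]⟩)
      (fun s => ⟨(1 - (s : ℝ)) • bottomCenter m, by
        rw [mem_closedBall_zero_iff, norm_smul, norm_bottomCenter, mul_one,
          Real.norm_of_nonneg (by linarith [s.2.2])]
        linarith [s.2.1]⟩)
  have hP : Continuous P := by
    refine continuous_sumElim.2 ⟨Continuous.subtype_mk ?_ _, Continuous.subtype_mk ?_ _⟩
    · exact (continuous_const.sub (continuous_subtype_val.comp continuous_fst)).smul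
        (hcof.comp continuous_snd)
    · fun_prop
  let K : C((I × (Fin m → I)) ⊕ I, Z) :=
    ⟨Sum.elim (fun q => H q) (fun _ => z), continuous_sumElim.2 ⟨by fun_prop, by fun_prop⟩⟩
  have hsmul : ∀ {s s' : I} {a b : Fin (m + 1) → ℝ}, ‖a‖ = 1 → ‖b‖ = 1 →
      (1 - (s : ℝ)) • a = (1 - (s' : ℝ)) • b → s = s' ∧ (s = 1 ∨ a = b) := by
    intro s s' a b ha hb h
    have h1 := congrArg norm h
    rw [norm_smul, norm_smul, ha, hb, mul_one, mul_one,
      Real.norm_of_nonneg (by linarith [s.2.2]), Real.norm_of_nonneg (by linarith [s'.2.2])] at h1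
    have h2 : s = s' := Subtype.ext (by linarith)
    subst h2
    refine ⟨rfl, ?_⟩
    by_cases h3 : s = 1
    · exact Or.inl h3
    · right
      refine smul_right_injective _ (sub_ne_zero.2 fun h4 => h3 (Subtype.ext h4.symm)) h
  have hPs : Function.Surjective P := by
    rintro ⟨x, hx⟩
    rw [mem_closedBall_zero_iff] at hx
    have hmemI : 1 - ‖x‖ ∈ Icc (0 : ℝ) 1 := ⟨by linarith, by linarith [norm_nonneg x]⟩
    by_cases h0 : x = 0
    · exact ⟨Sum.inr 1, Subtype.ext (by simp [P, h0])⟩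
    have hn : ‖‖x‖⁻¹ • x‖ = 1 := by simp [norm_smul, h0]
    have hx' : x = ‖x‖ • ‖x‖⁻¹ • x := by
      rw [smul_smul, mul_inv_cancel₀ (norm_ne_zero_iff.2 h0), one_smul]
    by_cases hb : ‖x‖⁻¹ • x = bottomCenter m
    · refine ⟨Sum.inr ⟨_, hmemI⟩, Subtype.ext ?_⟩
      simp only [P, Sum.elim_inr, sub_sub_cancel]
      rw [← hb, ← hx']
    · obtain ⟨u, hu, hu'⟩ := exists_collapse_eq hn hb
      refine ⟨Sum.inl (⟨_, hmemI⟩, toUnitCube u), Subtype.ext ?_⟩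
      simp only [P, Sum.elim_inl, sub_sub_cancel]
      rw [ofUnitCube_toUnitCube hu, hu', ← hx']
  have hfac : Function.FactorsThrough K P := by
    rintro (⟨s, y⟩ | s) (⟨s', y'⟩ | s') h
    · obtain ⟨rfl, h1⟩ := hsmul (norm_collapse (norm_ofUnitCube_le y))
        (norm_collapse (norm_ofUnitCube_le y')) (congrArg Subtype.val h)
      change H (s, y) = H (s, y')
      rcases h1 with rfl | h1
      · rw [H1, H1]
      · rcases eq_or_norm_eq_one_of_collapse_eq (norm_ofUnitCube_le y) (norm_ofUnitCube_le y') h1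
          with h2 | ⟨h2, h3⟩
        · rw [← toUnitCube_ofUnitCube y, h2, toUnitCube_ofUnitCube]
        · rw [Hb _ _ h2, Hb _ _ h3]
    · obtain ⟨rfl, h1⟩ := hsmul (norm_collapse (norm_ofUnitCube_le y)) norm_bottomCenter
        (congrArg Subtype.val h)
      change H (s, y) = z
      rcases h1 with rfl | h1
      · rw [H1]
      · rw [Hb _ _ (norm_eq_one_of_collapse_eq (norm_ofUnitCube_le y) h1)]
    · obtain ⟨rfl, h1⟩ := hsmul norm_bottomCenter (norm_collapse (norm_ofUnitCube_le y'))
        (congrArg Subtype.val h)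
      change z = H (s, y')
      rcases h1 with rfl | h1
      · rw [H1]
      · rw [Hb _ _ (norm_eq_one_of_collapse_eq (norm_ofUnitCube_le y') h1.symm)]
    · rfl
  have hq : Topology.IsQuotientMap (⟨P, hP⟩ : C(_, _)) :=
    hP.isClosedMap.isQuotientMap hP hPs
  have hlK : ∀ q, hq.lift K hfac (P q) = K q := fun q =>
    DFunLike.congr_fun (hq.lift_comp K hfac) q
  classical
  let G : (Fin (m + 1) → ℝ) → E := fun x =>
    if hx : x ∈ closedBall (0 : Fin (m + 1) → ℝ) 1 then i (hq.lift K hfac ⟨x, hx⟩) else i z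
  have hGr : ∀ x (hx : x ∈ closedBall (0 : Fin (m + 1) → ℝ) 1),
      G x = i (hq.lift K hfac ⟨x, hx⟩) := fun x hx => dif_pos hx
  refine ⟨G, ?_, fun x hx => ?_, fun x hx => ?_⟩
  · rw [continuousOn_iff_continuous_domRestrict]
    exact (hi.continuous.comp (hq.lift K hfac).continuous).congr fun x => (hGr x x.2).symm
  · rw [hGr x hx]
    exact mem_range_self _
  · have hx' := sphere_subset_closedBall hx
    have hn := mem_sphere_zero_iff_norm.1 hx
    rw [hGr x hx', ← hlift _ hx]
    congr 1
    by_cases hb : x = bottomCenter m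
    · have : (⟨x, hx'⟩ : closedBall (0 : Fin (m + 1) → ℝ) 1) = P (Sum.inr 0) :=
        Subtype.ext (by simp [P, hb])
      rw [this, hlK, hb]
      rfl
    · obtain ⟨u, hu, hu'⟩ := exists_collapse_eq hn hb
      have : (⟨x, hx'⟩ : closedBall (0 : Fin (m + 1) → ℝ) 1) = P (Sum.inl (0, toUnitCube u)) :=
        Subtype.ext (by simp [P, ofUnitCube_toUnitCube hu, hu'])
      rw [this, hlK]
      change H (0, _) = _
      rw [H0, ofUnitCube_toUnitCube hu, hu']

theorem IsConn.sphereExtendable {Z E : Type} [TopologicalSpace Z] [TopologicalSpace E] {n : ℤ}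
    (hZ : IsConn Z n) {i : Z → E} (hi : Topology.IsInducing i) {k : ℕ} (hk : (k : ℤ) ≤ n + 1) :
    SphereExtendable (range i) k := by
  obtain ⟨z⟩ : Nonempty Z := hZ.1 (by omega)
  have : Nonempty Z := ⟨z⟩
  cases k with
  | zero =>
    intro g _ _
    refine ⟨fun _ => i z, continuousOn_const, fun _ _ => mem_range_self z, fun x hx => ?_⟩
    rw [mem_sphere_zero_iff_norm, Subsingleton.elim x 0, norm_zero] at hx
    exact absurd hx zero_ne_one
  | succ m =>
    exact sphereExtendable_of_subsingleton_homotopyGroup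
      (fun z => hZ.2 m (by push_cast at hk; omega) z) hi

end Collapse

section Cells

open Set Metric

variable {d : ℕ}

/-- The cell of the integer cubical structure on `ℝ^d` with barycenter `c`: in each odd
coordinate of `c` it is an interval of length two, in each even coordinate a point. -/
def cubeCell (c : Fin d → ℤ) : Set (Fin d → ℝ) :=
  {x | ∀ i, |x i - c i| ≤ ((c i % 2 : ℤ) : ℝ)}

/-- The dimension of `cubeCell c`. -/
def cubeCellDim (c : Fin d → ℤ) : ℕ := (Finset.univ.filter fun i => c i % 2 = 1).card

/-- The relative boundary of `cubeCell c`. -/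
def cubeCellBoundary (c : Fin d → ℤ) : Set (Fin d → ℝ) :=
  {x | x ∈ cubeCell c ∧ ∃ i, c i % 2 = 1 ∧ |x i - c i| = 1}

/-- `c'` is a face of codimension one of `c`. -/
def IsFacet (c' c : Fin d → ℤ) : Prop :=
  ∃ i, c i % 2 = 1 ∧
    (c' = Function.update c i (c i + 1) ∨ c' = Function.update c i (c i - 1))

theorem isClosed_cubeCell (c : Fin d → ℤ) : IsClosed (cubeCell c) := by
  have : cubeCell c = ⋂ i, {x : Fin d → ℝ | |x i - c i| ≤ ((c i % 2 : ℤ) : ℝ)} := by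
    ext x
    simp [cubeCell]
  rw [this]
  exact isClosed_iInter fun i => isClosed_le (by fun_prop) continuous_const

theorem exists_isFacet_of_mem_boundary {c : Fin d → ℤ} {x : Fin d → ℝ}
    (hx : x ∈ cubeCellBoundary c) : ∃ c', IsFacet c' c ∧ x ∈ cubeCell c' := by
  obtain ⟨hx, i, hi, h⟩ := hx
  rcases (abs_eq zero_le_one).1 h with h | h
  · refine ⟨_, ⟨i, hi, Or.inl rfl⟩, fun j => ?_⟩
    by_cases hj : j = i
    · subst hj
      have e : x j - ((c j + 1 : ℤ) : ℝ) = 0 := by push_cast; linarith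
      rw [Function.update_self, e, abs_zero]
      exact_mod_cast Int.emod_nonneg _ two_ne_zero
    · rw [Function.update_of_ne hj]
      exact hx j
  · refine ⟨_, ⟨i, hi, Or.inr rfl⟩, fun j => ?_⟩
    by_cases hj : j = i
    · subst hj
      have e : x j - ((c j - 1 : ℤ) : ℝ) = 0 := by push_cast; linarith
      rw [Function.update_self, e, abs_zero]
      exact_mod_cast Int.emod_nonneg _ two_ne_zero
    · rw [Function.update_of_ne hj]
      exact hx j

theorem IsFacet.cubeCellDim_lt {c c' : Fin d → ℤ} (h : IsFacet c' c) :
    cubeCellDim c' < cubeCellDim c := by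
  obtain ⟨i, hi, h⟩ := h
  refine Finset.card_lt_card ((Finset.ssubset_iff_of_subset fun j hj => ?_).2 ⟨i, ?_, ?_⟩)
  · simp only [Finset.mem_filter, Finset.mem_univ, true_and] at hj ⊢
    by_cases hji : j = i
    · rw [hji]; exact hi
    · rcases h with rfl | rfl <;> rwa [Function.update_of_ne hji] at hj
  · simpa using hi
  · simp only [Finset.mem_filter, Finset.mem_univ, true_and]
    rcases h with rfl | rfl <;> rw [Function.update_self] <;> omega

theorem cubeCell_inter_subset_boundary {c c' : Fin d → ℤ} (hne : c' ≠ c)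
    (hd : cubeCellDim c' ≤ cubeCellDim c) {x : Fin d → ℝ} (hx : x ∈ cubeCell c)
    (hx' : x ∈ cubeCell c') : x ∈ cubeCellBoundary c := by
  by_contra hb
  have hlt : ∀ i, c i % 2 = 1 → |x i - c i| < 1 := fun i hi => by
    refine lt_of_le_of_ne ?_ fun h => hb ⟨hx, i, hi, h⟩
    have := hx i
    rwa [hi, Int.cast_one] at this
  have hodd : ∀ i, c i % 2 = 1 → c' i = c i := fun i hi => by
    have h1 := abs_lt.1 (hlt i hi)
    have h2 := hx' i
    rcases Int.emod_two_eq_zero_or_one (c' i) with h | h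
    · rw [h, Int.cast_zero] at h2
      have h3 : x i = c' i := sub_eq_zero.1 (abs_nonpos_iff.1 h2)
      rw [h3] at h1
      have h4 : (-1 : ℤ) < c' i - c i := by exact_mod_cast h1.1
      have h5 : c' i - c i < 1 := by exact_mod_cast h1.2
      omega
    · rw [h, Int.cast_one, abs_le] at h2
      have h4 : ((c' i - c i : ℤ) : ℝ) < 2 := by push_cast; linarith
      have h5 : (-2 : ℝ) < ((c' i - c i : ℤ) : ℝ) := by push_cast; linarith
      have h4' : c' i - c i < 2 := by exact_mod_cast h4
      have h5' : -2 < c' i - c i := by exact_mod_cast h5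
      omega
  have hsub : (Finset.univ.filter fun i => c i % 2 = 1) ⊆
      Finset.univ.filter fun i => c' i % 2 = 1 := fun i hi => by
    simp only [Finset.mem_filter, Finset.mem_univ, true_and] at hi ⊢
    rw [hodd i hi, hi]
  have heq := Finset.eq_of_subset_of_card_le hsub hd
  apply hne
  funext i
  rcases Int.emod_two_eq_zero_or_one (c i) with h | h
  · have h' : c' i % 2 = 0 := by
      rcases Int.emod_two_eq_zero_or_one (c' i) with h' | h'
      · exact h'
      · have : i ∈ Finset.univ.filter fun i => c i % 2 = 1 := by rw [heq]; simpa using h'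
        simp only [Finset.mem_filter, Finset.mem_univ, true_and] at this
        omega
    have h1 := hx i
    have h2 := hx' i
    rw [h, Int.cast_zero] at h1
    rw [h', Int.cast_zero] at h2
    have h1' : x i = c i := sub_eq_zero.1 (abs_nonpos_iff.1 h1)
    have h2' : x i = c' i := sub_eq_zero.1 (abs_nonpos_iff.1 h2)
    exact_mod_cast h2'.symm.trans h1'
  · exact hodd i h

theorem SphereExtendable.exists_extension_cubeCell {E : Type*} [TopologicalSpace E] {A : Set E}
    {c : Fin d → ℤ} (hA : SphereExtendable A (cubeCellDim c)) {g : (Fin d → ℝ) → E}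
    (hg : ContinuousOn g (cubeCellBoundary c)) (hgA : MapsTo g (cubeCellBoundary c) A) :
    ∃ G, ContinuousOn G (cubeCell c) ∧ MapsTo G (cubeCell c) A ∧
      EqOn G g (cubeCellBoundary c) := by
  let e : {i // c i % 2 = 1} ≃ Fin (cubeCellDim c) :=
    Fintype.equivFinOfCardEq (Fintype.card_subtype _)
  let α : (Fin (cubeCellDim c) → ℝ) → Fin d → ℝ := fun u i =>
    c i + if h : c i % 2 = 1 then u (e ⟨i, h⟩) else 0
  let β : (Fin d → ℝ) → Fin (cubeCellDim c) → ℝ := fun x j => x (e.symm j) - c (e.symm j)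
  have hα : Continuous α := continuous_pi fun i => by
    by_cases h : c i % 2 = 1 <;> simp only [α, h, dite_true, dite_false] <;> fun_prop
  have hβ : Continuous β := by fun_prop
  have hα_odd : ∀ u i (h : c i % 2 = 1), α u i - c i = u (e ⟨i, h⟩) := fun u i h => by
    simp [α, h]
  have hα_even : ∀ u i, ¬ c i % 2 = 1 → α u i - c i = 0 := fun u i h => by
    simp [α, h]
  have hβα : ∀ x ∈ cubeCell c, α (β x) = x := by
    intro x hx
    funext i
    by_cases h : c i % 2 = 1
    · simp [α, β, h]
    · have h0 : c i % 2 = 0 := by omega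
      have := hx i
      rw [h0, Int.cast_zero] at this
      simp only [α, h, dite_false, add_zero]
      exact (sub_eq_zero.1 (abs_nonpos_iff.1 this)).symm
  have hβball : MapsTo β (cubeCell c) (closedBall 0 1) := by
    intro x hx
    rw [mem_closedBall_zero_iff, pi_norm_le_iff_of_nonneg zero_le_one]
    intro j
    have := hx (e.symm j)
    rwa [(e.symm j).2, Int.cast_one] at this
  have hαcell : ∀ u : Fin (cubeCellDim c) → ℝ, ‖u‖ ≤ 1 → α u ∈ cubeCell c := by
    intro u hu i
    by_cases h : c i % 2 = 1
    · rw [hα_odd u i h, h, Int.cast_one]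
      exact (norm_le_pi_norm u _).trans hu
    · rw [hα_even u i h, abs_zero]
      exact_mod_cast Int.emod_nonneg _ two_ne_zero
  have hαb : MapsTo α (sphere 0 1) (cubeCellBoundary c) := by
    intro u hu
    rw [mem_sphere_zero_iff_norm] at hu
    refine ⟨hαcell u hu.le, ?_⟩
    obtain ⟨j, hj⟩ := exists_abs_eq_norm_of_norm_pos (x := u) (by simp [hu])
    refine ⟨e.symm j, (e.symm j).2, ?_⟩
    rw [hα_odd u _ (e.symm j).2]
    simpa [hu] using hj
  have hβs : ∀ x ∈ cubeCellBoundary c, β x ∈ sphere (0 : Fin (cubeCellDim c) → ℝ) 1 := by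
    rintro x ⟨hx, i, hi, h⟩
    have h1 := hβball hx
    rw [mem_closedBall_zero_iff] at h1
    rw [mem_sphere_zero_iff_norm]
    refine le_antisymm h1 ?_
    have h2 := norm_le_pi_norm (β x) (e ⟨i, hi⟩)
    simpa [β, h] using h2
  obtain ⟨G, hG, hGA, hGg⟩ := hA (g ∘ α) (hg.comp hα.continuousOn hαb) (hgA.comp hαb)
  refine ⟨G ∘ β, hG.comp hβ.continuousOn hβball, hGA.comp hβball, fun x hx => ?_⟩
  change G (β x) = g x
  rw [hGg (hβs x hx)]
  change g (α (β x)) = g x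
  rw [hβα x hx.1]

theorem exists_extension_of_carrier {E : Type*} [TopologicalSpace E]
    {A : (Fin d → ℤ) → Set E} (hmono : ∀ c c', IsFacet c' c → A c' ⊆ A c)
    {B : Set (Fin d → ℝ)} (hB : IsClosed B) {g : (Fin d → ℝ) → E} (hg : ContinuousOn g B)
    (S : Finset (Fin d → ℤ)) (hS : ∀ c ∈ S, ∀ c', IsFacet c' c → c' ∈ S)
    (hext : ∀ c ∈ S, SphereExtendable (A c) (cubeCellDim c))
    (hcell : ∀ c ∈ S, (cubeCell c ⊆ B ∧ MapsTo g (cubeCell c) (A c)) ∨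
      cubeCell c ∩ B ⊆ cubeCellBoundary c) :
    ∃ H : (Fin d → ℝ) → E, ContinuousOn H (B ∪ ⋃ c ∈ S, cubeCell c) ∧ EqOn H g B ∧
      ∀ c ∈ S, MapsTo H (cubeCell c) (A c) := by
  classical
  induction S using Finset.induction_on_max_value cubeCellDim with
  | empty => exact ⟨g, by simpa using hg, fun _ _ => rfl, by simp⟩
  | insert a s has hmax ih =>
    have hs : ∀ c ∈ s, ∀ c', IsFacet c' c → c' ∈ s := by
      intro c hc c' hc'
      rcases Finset.mem_insert.1 (hS c (Finset.mem_insert_of_mem hc) c' hc') with rfl | h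
      · exact absurd (hmax c hc) (not_le.2 hc'.cubeCellDim_lt)
      · exact h
    have ha_facet : ∀ c', IsFacet c' a → c' ∈ s := by
      intro c' hc'
      rcases Finset.mem_insert.1 (hS a (Finset.mem_insert_self _ _) c' hc') with rfl | h
      · exact absurd hc'.cubeCellDim_lt (lt_irrefl _)
      · exact h
    obtain ⟨H, hH, hHg, hHA⟩ := ih hs (fun c hc => hext c (Finset.mem_insert_of_mem hc))
      (fun c hc => hcell c (Finset.mem_insert_of_mem hc))
    have hunion : B ∪ ⋃ c ∈ insert a s, cubeCell c =
        (B ∪ ⋃ c ∈ s, cubeCell c) ∪ cubeCell a := by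
      rw [Finset.set_biUnion_insert, union_comm (cubeCell a), union_assoc]
    rw [hunion]
    rcases hcell a (Finset.mem_insert_self _ _) with ⟨h1, h2⟩ | h1
    · refine ⟨H, ?_, hHg, fun c hc => ?_⟩
      · rwa [union_eq_self_of_subset_right (h1.trans subset_union_left)]
      · rcases Finset.mem_insert.1 hc with rfl | hc
        · exact h2.congr fun x hx => (hHg (h1 hx)).symm
        · exact hHA c hc
    · have hbsub : cubeCellBoundary a ⊆ ⋃ c ∈ s, cubeCell c := fun x hx => by
        obtain ⟨c', hc', hx'⟩ := exists_isFacet_of_mem_boundary hx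
        exact mem_biUnion (ha_facet c' hc') hx'
      have hHb : MapsTo H (cubeCellBoundary a) (A a) := fun x hx => by
        obtain ⟨c', hc', hx'⟩ := exists_isFacet_of_mem_boundary hx
        exact hmono a c' hc' (hHA c' (ha_facet c' hc') hx')
      obtain ⟨G, hG, hGA, hGH⟩ := (hext a (Finset.mem_insert_self _ _)).exists_extension_cubeCell
        (hH.mono (hbsub.trans subset_union_right)) hHb
      obtain ⟨F, hF, hF1, hF2⟩ := exists_glue_continuousOn
        (hB.union (s.finite_toSet.isClosed_biUnion fun c _ => isClosed_cubeCell c))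
        (isClosed_cubeCell a) hH hG (by
          rintro x (hx | hx) hxa
          · exact (hGH (h1 ⟨hxa, hx⟩)).symm
          · obtain ⟨c, hc, hxc⟩ := mem_iUnion₂.1 hx
            exact (hGH (cubeCell_inter_subset_boundary (fun h => has (by rwa [h] at hc)) (hmax c hc)
              hxa hxc)).symm)
      refine ⟨F, hF, fun x hx => ?_, fun c hc => ?_⟩
      · rw [hF1 (Or.inl hx), hHg hx]
      · rcases Finset.mem_insert.1 hc with rfl | hc
        · exact hGA.congr fun x hx => (hF2 hx).symm
        · exact (hHA c hc).congr fun x hx => (hF1 (Or.inr (mem_biUnion hc hx))).symm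

end Cells

section Coloring

open Set Metric

variable {d : ℕ}

/-- The top-dimensional cells of the subdivided cube `[-R, R]^d` that contain `cubeCell c`. -/
noncomputable def topCells (R : ℤ) (c : Fin d → ℤ) : Finset (Fin d → ℤ) :=
  (Fintype.piFinset fun _ => Finset.Icc (-R) R).filter
    fun q => ∀ i, q i % 2 = 1 ∧ |q i - c i| ≤ 1

theorem mem_topCells {R : ℤ} {c q : Fin d → ℤ} :
    q ∈ topCells R c ↔ (∀ i, |q i| ≤ R) ∧ ∀ i, q i % 2 = 1 ∧ |q i - c i| ≤ 1 := by
  simp [topCells, abs_le]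

theorem eq_of_offset_eq {h A A' s s' : ℤ} {K j k : ℕ} (hK : (K : ℤ) + 2 ≤ h) (hj : j < K)
    (hk : k < K) (hs : s = 2 * h + 2 * j + 2 ∨ s = -(2 * h + 2 * j + 2))
    (hs' : s' = 2 * h + 2 * k + 2 ∨ s' = -(2 * h + 2 * k + 2))
    (he : 4 * h * A + s = 4 * h * A' + s') : j = k := by
  obtain ⟨D, rfl⟩ : ∃ D, A = A' + D := ⟨A - A', by ring⟩
  have hD : 4 * h * D = s' - s := by linarith
  have h1 : D < 2 := by
    by_contra! hc
    nlinarith [mul_le_mul_of_nonneg_left hc (show (0 : ℤ) ≤ 4 * h by omega),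
      show s' - s < 8 * h by omega]
  have h2 : -2 < D := by
    by_contra! hc
    nlinarith [mul_le_mul_of_nonneg_left hc (show (0 : ℤ) ≤ 4 * h by omega),
      show -(8 * h) < s' - s by omega]
  interval_cases D <;> omega

theorem card_image_add_cubeCellDim_le {c : Fin d → ℤ} {h : ℤ} {K : ℕ} (hK : (K : ℤ) + 2 ≤ h)
    (a : ℕ → Fin d → ℤ) {T : Finset (Fin d → ℤ)}
    (hT : ∀ q ∈ T, ∀ i, q i % 2 = 1 ∧ |q i - c i| ≤ 1) (j : (Fin d → ℤ) → ℕ)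
    (hjK : ∀ q ∈ T, j q < K)
    (hj : ∀ q ∈ T, ∀ i, |q i - 4 * h * a (j q) i| ≤ 2 * h + 2 * j q + 2)
    (hj' : ∀ q ∈ T, ∀ k < j q, ∃ i, 2 * h + 2 * k + 2 < |q i - 4 * h * a k i|) :
    (T.image j).card + cubeCellDim c ≤ d + 1 := by
  have hd : (Finset.univ.filter fun i => ¬ c i % 2 = 1).card + cubeCellDim c = d := by
    rw [cubeCellDim, add_comm, Finset.card_filter_add_card_filter_not, Finset.card_univ,
      Fintype.card_fin]
  rcases (T.image j).eq_empty_or_nonempty with h0 | hne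
  · rw [h0, Finset.card_empty]
    omega
  set M := (T.image j).max' hne with hM
  have hMmem : M ∈ T.image j := Finset.max'_mem _ _
  obtain ⟨q', hq', hq'M⟩ := Finset.mem_image.1 hMmem
  have key : ∀ k ∈ (T.image j).erase M, ∃ i, ∃ s : ℤ, ¬ c i % 2 = 1 ∧
      (s = 2 * h + 2 * k + 2 ∨ s = -(2 * h + 2 * k + 2)) ∧ c i = 4 * h * a k i + s := by
    intro k hk
    obtain ⟨hkM, hk⟩ := Finset.mem_erase.1 hk
    have hlt : k < M := lt_of_le_of_ne (Finset.le_max' _ _ hk) hkM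
    obtain ⟨q, hq, rfl⟩ := Finset.mem_image.1 hk
    obtain ⟨i, hi⟩ := hj' q' hq' _ (by rw [hq'M]; exact hlt)
    have h1 := hj q hq i
    obtain ⟨h2, h3⟩ := hT q hq i
    obtain ⟨h4, h5⟩ := hT q' hq' i
    refine ⟨i, c i - 4 * h * a (j q) i, ?_⟩
    have h6 : 4 * h * a (j q) i = 2 * (2 * (h * a (j q) i)) := by ring
    rw [h6] at h1 hi ⊢
    rw [abs_le] at h1 h3 h5
    rw [lt_abs] at hi
    omega
  have hle : ((T.image j).erase M).card ≤ (Finset.univ.filter fun i => ¬ c i % 2 = 1).card := by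
    refine Finset.card_le_card_of_forall_subsingleton (fun (k : ℕ) i => ∃ s : ℤ,
      (s = 2 * h + 2 * k + 2 ∨ s = -(2 * h + 2 * k + 2)) ∧ c i = 4 * h * a k i + s)
      (fun k hk => ?_) ?_
    · obtain ⟨i, s, hi, hs⟩ := key k hk
      exact ⟨i, by simpa using hi, s, hs⟩
    · rintro i - k ⟨hk, s, hs, he⟩ k' ⟨hk', s', hs', he'⟩
      have hlt : ∀ k ∈ (T.image j).erase M, k < K := fun k hk => by
        obtain ⟨q, hq, rfl⟩ := Finset.mem_image.1 (Finset.mem_of_mem_erase hk)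
        exact hjK q hq
      exact eq_of_offset_eq hK (hlt k hk) (hlt k' hk') hs hs' (he.symm.trans he')
  rw [Finset.card_erase_of_mem hMmem] at hle
  omega

theorem exists_cubical_coloring (d : ℕ) {δ : ℝ} (hδ : 0 < δ) :
    ∃ R : ℤ, 0 < R ∧ R % 2 = 0 ∧ ∃ col : (Fin d → ℤ) → Fin d → ℝ,
      (∀ q : Fin d → ℤ, (∀ i, q i % 2 = 1) → (∀ i, |q i| ≤ R) → col q ∈ closedBall 0 1 ∧
        ∀ x ∈ cubeCell q, dist ((R : ℝ)⁻¹ • x) (col q) < δ) ∧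
      ∀ c : Fin d → ℤ, ((topCells R c).image col).card + cubeCellDim c ≤ d + 1 := by
  classical
  obtain ⟨N, hN⟩ := exists_nat_gt (1 / δ)
  have hN0 : (0 : ℝ) < N := (one_div_pos.2 hδ).trans hN
  have hNδ : 1 / (N : ℝ) < δ := (one_div_lt hδ hN0).1 hN
  have hN0' : (0 : ℤ) < N := by exact_mod_cast hN0
  let L := (Fintype.piFinset fun _ : Fin d => Finset.Icc (-(N : ℤ)) N).toList
  let a : ℕ → Fin d → ℤ := fun k => L.getD k 0
  obtain ⟨h, hh⟩ : ∃ h : ℤ, h = L.length + 2 := ⟨_, rfl⟩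
  have hh0 : 0 < h := by omega
  have ha : ∀ k < L.length, ∀ i, |a k i| ≤ N := by
    intro k hk i
    have h1 : a k ∈ L := by
      simp only [a, List.getD_eq_getElem _ _ hk]
      exact List.getElem_mem hk
    have h2 := Finset.mem_toList.1 h1
    rw [Fintype.mem_piFinset] at h2
    exact abs_le.2 (Finset.mem_Icc.1 (h2 i))
  have hbox : ∀ q : Fin d → ℤ, (∀ i, |q i| ≤ 4 * h * N) →
      ∃ k, k < L.length ∧ ∀ i, |q i - 4 * h * a k i| ≤ 2 * h + 2 * k + 2 := by
    intro q hq
    have hdiv := fun i => Int.emod_add_mul_ediv (q i + 2 * h) (4 * h)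
    have hlo := fun i => Int.emod_nonneg (q i + 2 * h) (show 4 * h ≠ 0 by omega)
    have hhi := fun i => Int.emod_lt_of_pos (q i + 2 * h) (show 0 < 4 * h by omega)
    have hmem : (fun i => (q i + 2 * h) / (4 * h)) ∈ L := by
      refine Finset.mem_toList.2 (Fintype.mem_piFinset.2 fun i => Finset.mem_Icc.2 ?_)
      have h1 := abs_le.1 (hq i)
      constructor
      · rw [Int.le_ediv_iff_mul_le (by omega)]
        nlinarith
      · rw [← Int.lt_add_one_iff, Int.ediv_lt_iff_lt_mul (by omega)]
        nlinarith
    obtain ⟨k, hk, hak⟩ := List.mem_iff_getElem.1 hmem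
    refine ⟨k, hk, fun i => ?_⟩
    have h1 : a k i = (q i + 2 * h) / (4 * h) := by
      simp only [a, List.getD_eq_getElem _ _ hk, hak]
    rw [h1, abs_le]
    have h2 := hdiv i
    have h3 := hlo i
    have h4 := hhi i
    constructor <;> linarith
  let p : (Fin d → ℤ) → ℕ → Prop := fun q k =>
    k < L.length ∧ ∀ i, |q i - 4 * h * a k i| ≤ 2 * h + 2 * k + 2
  let j : (Fin d → ℤ) → ℕ := fun q => if hq : ∃ k, p q k then Nat.find hq else 0
  have hj : ∀ q : Fin d → ℤ, (∀ i, |q i| ≤ 4 * h * N) → p q (j q) := fun q hq => by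
    have hq' : ∃ k, p q k := hbox q hq
    simp only [j, dif_pos hq']
    exact Nat.find_spec hq'
  have hj' : ∀ q : Fin d → ℤ, (∀ i, |q i| ≤ 4 * h * N) → ∀ k < j q, ¬ p q k :=
      fun q hq k hk => by
    have hq' : ∃ k, p q k := hbox q hq
    simp only [j, dif_pos hq'] at hk
    exact Nat.find_min hq' hk
  have hh0' : (0 : ℝ) < h := by exact_mod_cast hh0
  refine ⟨4 * h * N, by positivity, by rw [mul_assoc]; omega,
    fun q i => (a (j q) i : ℝ) / N, fun q hodd hq => ?_, fun c => ?_⟩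
  · obtain ⟨hjL, hjb⟩ := hj q hq
    refine ⟨?_, fun x hx => ?_⟩
    · rw [mem_closedBall_zero_iff, pi_norm_le_iff_of_nonneg zero_le_one]
      intro i
      rw [Real.norm_eq_abs, abs_div, abs_of_pos hN0, div_le_one hN0]
      exact_mod_cast ha _ hjL i
    · refine lt_of_le_of_lt ((dist_pi_le_iff (by positivity)).2 fun i => ?_) hNδ
      have h1 := hx i
      rw [hodd i, Int.cast_one] at h1
      have h2 : |(q i : ℝ) - 4 * h * a (j q) i| ≤ 2 * h + 2 * j q + 2 := by
        exact_mod_cast hjb i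
      have h3 : (2 * h + 2 * j q + 2 : ℝ) + 1 ≤ 4 * h := by
        have : 2 * h + 2 * (j q : ℤ) + 2 + 1 ≤ 4 * h := by omega
        exact_mod_cast this
      have h4 : |x i - 4 * h * a (j q) i| ≤ 4 * h := by
        rw [abs_le] at h1 h2 ⊢
        constructor <;> linarith
      have h5 : (((4 * h * N : ℤ) : ℝ)⁻¹ • x) i - (a (j q) i : ℝ) / N =
          (x i - 4 * h * a (j q) i) / (4 * h * N) := by
        simp only [Pi.smul_apply, smul_eq_mul]
        push_cast
        field_simp
      rw [Real.dist_eq, h5, abs_div, abs_of_pos (by positivity : (0 : ℝ) < 4 * h * N),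
        div_le_div_iff₀ (by positivity) hN0]
      nlinarith
  · have h1 : ∀ q ∈ topCells (4 * h * N) c, p q (j q) := fun q hq => hj q (mem_topCells.1 hq).1
    have h2 := card_image_add_cubeCellDim_le (c := c) hh.ge a
      (fun q hq => (mem_topCells.1 hq).2) j (fun q hq => (h1 q hq).1) (fun q hq => (h1 q hq).2)
      (fun q hq k hk => by
        have h3 := hj' q (mem_topCells.1 hq).1 k hk
        have h4 := (h1 q hq).1
        simp only [p, not_and, not_forall, not_le] at h3
        exact h3 (by omega))
    refine le_trans (Nat.add_le_add_right ?_ _) h2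
    have h3 : (fun (q : Fin d → ℤ) i => (a (j q) i : ℝ) / N) =
        (fun k i => (a k i : ℝ) / N) ∘ j := rfl
    rw [h3, ← Finset.image_image]
    exact Finset.card_image_le

end Coloring

section TopCells

open Set Metric

variable {d : ℕ} {R : ℤ} {c : Fin d → ℤ}

theorem topCells_nonempty (hR : 0 < R) (hR2 : R % 2 = 0) (hc : ∀ i, |c i| ≤ R) :
    (topCells R c).Nonempty := by
  refine ⟨fun i => if c i % 2 = 1 then c i else if c i = R then R - 1 else c i + 1,
    mem_topCells.2 ⟨fun i => ?_, fun i => ?_⟩⟩ <;>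
  · have := abs_le.1 (hc i)
    simp only [abs_le]
    split_ifs <;> omega

theorem IsFacet.topCells_subset {c' : Fin d → ℤ} (h : IsFacet c' c) :
    topCells R c ⊆ topCells R c' := by
  intro q hq
  rw [mem_topCells] at hq ⊢
  refine ⟨hq.1, fun j => ⟨(hq.2 j).1, ?_⟩⟩
  obtain ⟨i, hi, h⟩ := h
  have hj := hq.2 j
  rw [abs_le] at hj ⊢
  by_cases hji : j = i
  · subst hji
    rcases h with rfl | rfl <;> rw [Function.update_self] <;> omega
  · rcases h with rfl | rfl <;> rw [Function.update_of_ne hji] <;> exact hj.2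

theorem IsFacet.abs_le {c' : Fin d → ℤ} (h : IsFacet c' c) (hR2 : R % 2 = 0)
    (hc : ∀ i, |c i| ≤ R) (j : Fin d) : |c' j| ≤ R := by
  obtain ⟨i, hi, h⟩ := h
  have hj := hc j
  rw [_root_.abs_le] at hj ⊢
  by_cases hji : j = i
  · subst hji
    rcases h with rfl | rfl <;> rw [Function.update_self] <;> omega
  · rcases h with rfl | rfl <;> rw [Function.update_of_ne hji] <;> exact hj

theorem cubeCell_subset_of_mem_topCells {q : Fin d → ℤ} (hq : q ∈ topCells R c) :
    cubeCell c ⊆ cubeCell q := by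
  intro x hx i
  obtain ⟨hq1, hq2⟩ := (mem_topCells.1 hq).2 i
  have h := hx i
  rw [hq1, Int.cast_one]
  rcases Int.emod_two_eq_zero_or_one (c i) with h0 | h0
  · rw [h0, Int.cast_zero, abs_nonpos_iff, sub_eq_zero] at h
    rw [h, abs_sub_comm]
    exact_mod_cast hq2
  · have : q i = c i := by
      rw [abs_le] at hq2
      omega
    rwa [this, ← Int.cast_one, ← h0]

theorem abs_le_of_mem_cubeCell (hR2 : R % 2 = 0) (hc : ∀ i, |c i| ≤ R) {x : Fin d → ℝ}
    (hx : x ∈ cubeCell c) (i : Fin d) : |x i| ≤ R := by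
  have h := hx i
  have h2 : |c i| + c i % 2 ≤ R := by
    have := hc i
    rcases abs_cases (c i) with h | h <;> omega
  calc |x i| = |(x i - c i) + c i| := by rw [sub_add_cancel]
    _ ≤ |x i - c i| + |(c i : ℝ)| := abs_add_le _ _
    _ ≤ ((c i % 2 : ℤ) : ℝ) + |(c i : ℝ)| := by gcongr
    _ ≤ R := by rw [add_comm]; exact_mod_cast h2

theorem intCast_mem_cubeCell (c : Fin d → ℤ) : (fun i => (c i : ℝ)) ∈ cubeCell c := fun i => by
  rw [sub_self, abs_zero]
  exact_mod_cast Int.emod_nonneg _ two_ne_zero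

theorem exists_mem_cubeCell (hR : 0 < R) (hR2 : R % 2 = 0) {x : Fin d → ℝ}
    (hx : ∀ i, |x i| ≤ R) : ∃ c : Fin d → ℤ, (∀ i, |c i| ≤ R) ∧ x ∈ cubeCell c := by
  have key : ∀ i, ∃ z : ℤ, |z| ≤ R ∧ |x i - z| ≤ ((z % 2 : ℤ) : ℝ) := by
    intro i
    have hxi := abs_le.1 (hx i)
    have hlo : (⌊x i / 2⌋ : ℝ) ≤ x i / 2 := Int.floor_le _
    have hhi : x i / 2 < ⌊x i / 2⌋ + 1 := Int.lt_floor_add_one _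
    set f := ⌊x i / 2⌋
    have h1 : -R - 2 < 2 * f := by
      have : (-R - 2 : ℝ) < 2 * f := by linarith
      exact_mod_cast this
    have h2 : 2 * f ≤ R := by
      have : (2 * f : ℝ) ≤ R := by linarith
      exact_mod_cast this
    by_cases hf : 2 * f = R
    · refine ⟨R, (abs_of_pos hR).le, ?_⟩
      have h3 : (2 * f : ℝ) = R := by exact_mod_cast hf
      have h4 : x i = R := by linarith
      simp [h4, hR2]
    · refine ⟨2 * f + 1, abs_le.2 (by omega), ?_⟩
      rw [show (2 * f + 1) % 2 = 1 by omega, Int.cast_one, abs_le]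
      push_cast
      constructor <;> linarith
  choose c hc using key
  exact ⟨c, fun i => (hc i).1, fun i => (hc i).2⟩

theorem cubeCell_subset_sphere_or (hR : 0 < R) (hR2 : R % 2 = 0) (hc : ∀ i, |c i| ≤ R) :
    cubeCell c ⊆ sphere 0 R ∨ cubeCell c ∩ sphere 0 R ⊆ cubeCellBoundary c := by
  have hR' : (0 : ℝ) < R := by exact_mod_cast hR
  by_cases h : ∃ i, |c i| = R
  · left
    obtain ⟨i, hi⟩ := h
    intro x hx
    rw [mem_sphere_zero_iff_norm]
    refine le_antisymm ((pi_norm_le_iff_of_nonneg hR'.le).2 (abs_le_of_mem_cubeCell hR2 hc hx)) ?_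
    have h0 : c i % 2 = 0 := by rcases abs_cases (c i) with h | h <;> omega
    have hxi := hx i
    rw [h0, Int.cast_zero, abs_nonpos_iff, sub_eq_zero] at hxi
    have h1 := norm_le_pi_norm x i
    rw [hxi, Real.norm_eq_abs] at h1
    rwa [← hi, Int.cast_abs]
  · right
    push Not at h
    rintro x ⟨hx, hxR⟩
    rw [mem_sphere_zero_iff_norm] at hxR
    obtain ⟨i, hi⟩ := exists_abs_eq_norm_of_norm_pos (x := x) (by rw [hxR]; exact hR')
    rw [hxR] at hi
    have hlt : |c i| ≤ R - 1 := by have := hc i; have := h i; omega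
    have hlt' : |(c i : ℝ)| ≤ R - 1 := by exact_mod_cast hlt
    have h1 : 1 ≤ |x i - c i| := by
      have := abs_sub_abs_le_abs_sub (x i) (c i)
      linarith
    have h2 := hx i
    rcases Int.emod_two_eq_zero_or_one (c i) with h0 | h0
    · rw [h0, Int.cast_zero] at h2
      linarith
    · rw [h0, Int.cast_one] at h2
      exact ⟨hx, i, h0, le_antisymm h2 h1⟩

end TopCells

namespace ASC

open Set Metric

variable {V W : Type} [DecidableEq V] [DecidableEq W] {X : ASC V} {Y : ASC W} {φ : V → W}

theorem overBarycenter_subset_overStar (X : ASC V) (φ : V → W) (σ : Finset W) :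
    X.overBarycenter φ σ ⊆ X.overStar φ σ := by
  rintro x ⟨hx, hxσ⟩
  refine ⟨hx, fun w hw => ?_⟩
  have : 0 < σ.card := Finset.card_pos.2 ⟨w, hw⟩
  simp only [hxσ, hw, if_true]
  positivity

theorem sphereExtendable_overStar {σ : Finset W} (hσ : σ.Nonempty) {m : ℤ}
    (h : IsConn (↥{x : ↥X.space |
      push φ (x : V → ℝ) = fun w => if w ∈ σ then (σ.card : ℝ)⁻¹ else 0}) m)
    {k : ℕ} (hk : (k : ℤ) ≤ m + 1) : SphereExtendable (X.overStar φ σ) k := by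
  have hr := h.sphereExtendable
    (Topology.IsInducing.subtypeVal.comp Topology.IsInducing.subtypeVal) hk
  have he : range ((Subtype.val : X.space → V → ℝ) ∘ (Subtype.val : ↥{x : ↥X.space |
      push φ (x : V → ℝ) = fun w => if w ∈ σ then (σ.card : ℝ)⁻¹ else 0} → X.space)) =
      X.overBarycenter φ σ := by
    ext x
    constructor
    · rintro ⟨y, rfl⟩
      exact ⟨y.1.2, y.2⟩
    · rintro ⟨h1, h2⟩
      exact ⟨⟨⟨x, h1⟩, h2⟩, rfl⟩
  rw [he] at hr
  refine hr.of_deformation (overBarycenter_subset_overStar X φ σ)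
    (fun p => (1 - p.1) • toBarycenter φ σ p.2 + p.1 • p.2) ?_
    (fun t ht x hx => segment_toBarycenter_mem hσ hx ht)
    (fun x hx => by simpa using toBarycenter_mem hσ hx) (fun x _ => by simp)
  have hc : ContinuousOn (fun p : ℝ × (V → ℝ) => toBarycenter φ σ p.2)
      (Icc 0 1 ×ˢ X.overStar φ σ) :=
    (continuousOn_toBarycenter X φ σ).comp continuousOn_snd fun p hp => hp.2
  exact ((continuousOn_const.sub continuousOn_fst).smul hc).add
    (continuousOn_fst.smul continuousOn_snd)

theorem sphereExtendable_space (hφ : X.IsSimplicial Y φ) {d : ℕ}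
    (hY : SphereExtendable Y.space d)
    (hX : ∀ σ ∈ Y.faces, ∀ k : ℕ, σ.card + k ≤ d + 1 → SphereExtendable (X.overStar φ σ) k) :
    SphereExtendable X.space d := by
  intro g hg hgX
  obtain ⟨G, hG, hGY, hGg⟩ := hY (fun x => push φ (g x))
    ((continuousOn_push X φ).comp hg hgX) fun x hx => push_mem_space hφ (hgX hx)
  have hu : ∀ w, ∃ u, IsOpen u ∧ ∀ x ∈ closedBall (0 : Fin d → ℝ) 1, x ∈ u ↔ 0 < G x w := by
    intro w
    obtain ⟨u, hu, h⟩ := continuousOn_iff'.1 (continuousOn_pi.1 hG w) (Ioi 0) isOpen_Ioi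
    refine ⟨u, hu, fun x hx => ?_⟩
    have := Set.ext_iff.1 h x
    simp only [mem_inter_iff, hx, and_true, mem_preimage, mem_Ioi] at this
    exact this.symm
  choose u huo hu using hu
  obtain ⟨δ, hδ, hleb⟩ := lebesgue_number_lemma_of_metric
    (isCompact_closedBall (0 : Fin d → ℝ) 1) huo fun x hx => by
      obtain ⟨w, hw⟩ := exists_pos_of_mem_space (hGY hx)
      exact mem_iUnion.2 ⟨w, (hu w x hx).2 hw⟩
  have : Nonempty W := (hleb 0 (by simp)).nonempty
  choose! label hlabel using hleb
  obtain ⟨R, hR, hR2, col, hcol, hcard⟩ := exists_cubical_coloring d hδ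
  have hR' : (0 : ℝ) < R := by exact_mod_cast hR
  let S : Finset (Fin d → ℤ) := Fintype.piFinset fun _ => Finset.Icc (-R) R
  have hS : ∀ {c}, c ∈ S ↔ ∀ i, |c i| ≤ R := by simp [S, abs_le]
  let σ : (Fin d → ℤ) → Finset W := fun c => (topCells R c).image (label ∘ col)
  have hσcard : ∀ c, (σ c).card + cubeCellDim c ≤ d + 1 := fun c => by
    refine le_trans (Nat.add_le_add_right ?_ _) (hcard c)
    simp only [σ, ← Finset.image_image]
    exact Finset.card_image_le
  have hscale : ∀ x : Fin d → ℝ, ‖(R : ℝ)⁻¹ • x‖ = ‖x‖ / R := fun x => by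
    rw [norm_smul, norm_inv, Real.norm_of_nonneg hR'.le, inv_mul_eq_div]
  have hball : ∀ c ∈ S, ∀ x ∈ cubeCell c, (R : ℝ)⁻¹ • x ∈ closedBall (0 : Fin d → ℝ) 1 := by
    intro c hc x hx
    rw [mem_closedBall_zero_iff, hscale, div_le_one hR', pi_norm_le_iff_of_nonneg hR'.le]
    exact abs_le_of_mem_cubeCell hR2 (hS.1 hc) hx
  have hpos : ∀ c ∈ S, ∀ x ∈ cubeCell c, ∀ w ∈ σ c, 0 < G ((R : ℝ)⁻¹ • x) w := by
    intro c hc x hx w hw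
    obtain ⟨q, hq, rfl⟩ := Finset.mem_image.1 hw
    obtain ⟨hq1, hq2⟩ := mem_topCells.1 hq
    obtain ⟨h1, h2⟩ := hcol q (fun i => (hq2 i).1) hq1
    exact (hu _ _ (hball c hc x hx)).1
      (hlabel _ h1 (h2 x (cubeCell_subset_of_mem_topCells hq hx)))
  have hface : ∀ c ∈ S, σ c ∈ Y.faces := fun c hc =>
    mem_faces_of_pos (hGY (hball c hc _ (intCast_mem_cubeCell c)))
      ((topCells_nonempty hR hR2 (hS.1 hc)).image _) (hpos c hc _ (intCast_mem_cubeCell c))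
  have hsph : MapsTo (fun x : Fin d → ℝ => (R : ℝ)⁻¹ • x) (sphere 0 R) (sphere 0 1) := by
    intro x hx
    rw [mem_sphere_zero_iff_norm] at hx ⊢
    rw [hscale, hx, div_self hR'.ne']
  obtain ⟨H, hH, hHg, hHA⟩ := exists_extension_of_carrier (A := fun c => X.overStar φ (σ c))
    (fun c c' h x hx => ⟨hx.1, fun w hw =>
      hx.2 w (Finset.image_subset_image h.topCells_subset hw)⟩)
    (isClosed_sphere (x := 0) (ε := (R : ℝ))) (hg.comp (by fun_prop) hsph) S
    (fun c hc c' h => hS.2 (h.abs_le hR2 (hS.1 hc)))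
    (fun c hc => hX _ (hface c hc) _ (hσcard c))
    (fun c hc => (cubeCell_subset_sphere_or hR hR2 (hS.1 hc)).imp_left fun h =>
      ⟨h, fun x hx => ⟨hgX (hsph (h hx)), fun w hw => by
        have := hpos c hc x hx w hw
        rwa [hGg (hsph (h hx))] at this⟩⟩)
  have hcover : ∀ x ∈ closedBall (0 : Fin d → ℝ) 1, ∃ c ∈ S, (R : ℝ) • x ∈ cubeCell c := by
    intro x hx
    obtain ⟨c, hc, hxc⟩ := exists_mem_cubeCell hR hR2 (x := (R : ℝ) • x) fun i => by
      rw [mem_closedBall_zero_iff] at hx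
      rw [Pi.smul_apply, smul_eq_mul, abs_mul, abs_of_pos hR']
      exact mul_le_of_le_one_right hR'.le ((norm_le_pi_norm x i).trans hx)
    exact ⟨c, hS.2 hc, hxc⟩
  refine ⟨fun x => H ((R : ℝ) • x), hH.comp (by fun_prop) fun x hx => ?_, fun x hx => ?_,
    fun x hx => ?_⟩
  · obtain ⟨c, hc, hxc⟩ := hcover x hx
    exact Or.inr (mem_biUnion hc hxc)
  · obtain ⟨c, hc, hxc⟩ := hcover x hx
    exact (hHA c hc hxc).1
  · have h1 : (R : ℝ) • x ∈ sphere (0 : Fin d → ℝ) R := by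
      rw [mem_sphere_zero_iff_norm] at hx ⊢
      rw [norm_smul, hx, mul_one, Real.norm_of_nonneg hR'.le]
    simp only [hHg h1, Function.comp_apply, inv_smul_smul₀ hR'.ne']

end ASC

/-- **Fiber connectivity.** If `f : X → Y` is a simplicial map, `Y` is `n`-connected, and for
each `k`-simplex `σ` of `Y` the fiber of the realization of `f` over the barycenter of `σ` is
`(n−k)`-connected, then `X` is `n`-connected. -/
theorem fiber_connectivity {V W : Type} [DecidableEq V] [DecidableEq W]
    (X : ASC V) (Y : ASC W) (φ : V → W) (hφ : X.IsSimplicial Y φ) (n : ℤ)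
    (hY : IsConn (↥Y.space) n)
    (hfib : ∀ σ ∈ Y.faces,
      IsConn (↥{x : ↥X.space |
          ASC.push φ (x : V → ℝ) = fun w => if w ∈ σ then (σ.card : ℝ)⁻¹ else 0})
        (n - σ.card + 1)) :
    IsConn (↥X.space) n := by
  refine ⟨fun hn => ?_, fun i hi x => ?_⟩
  · obtain ⟨y⟩ := hY.1 hn
    obtain ⟨w, hw⟩ := ASC.exists_pos_of_mem_space y.2
    have hwY : {w} ∈ Y.faces :=
      ASC.mem_faces_of_pos y.2 (Finset.singleton_nonempty w) (by simpa using hw)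
    obtain ⟨x⟩ := (hfib _ hwY).1 (by simpa using hn)
    exact ⟨x.1⟩
  · have hYe : SphereExtendable Y.space (i + 1) := by
      have h := hY.sphereExtendable Topology.IsInducing.subtypeVal (k := i + 1)
        (by push_cast; omega)
      rwa [Subtype.range_coe] at h
    refine (ASC.sphereExtendable_space hφ hYe fun σ hσ k hk => ?_).subsingleton_homotopyGroup x
    exact ASC.sphereExtendable_overStar (Y.nonempty_of_mem hσ) (hfib σ hσ) (by omega)
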